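/- Let d ≥ 1, let μ be the Haar probability measure on the unitary group U(d), and let ρ be a d×d complex matrix. Then ∫ V ρ V† dμ(V) = (Tr[ρ]/d)·I, where I is the d×d identity matrix. In particular, if ρ has trace 1 then the Haar average of V ρ V† is I/d. -/

import Mathlib

open MeasureTheory Matrix
open scoped Kronecker ComplexOrder

noncomputable section

attribute [local instance] Matrix.frobeniusNormedAddCommGroup Matrix.frobeniusNormedSpace

local instance {n m : Type*} [Fintype n] [Fintype m] : MeasurableSpace (Matrix n m ℂ) :=
  borel _

local instance {n m : Type*} [Fintype n] [Fintype m] : BorelSpace (Matrix n m ℂ) := ⟨rfl⟩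

/-- The Frobenius (Hilbert–Schmidt) norm `‖M‖₂ = √Tr[M† M]`. -/
def frobNorm {n : Type*} [Fintype n] (M : Matrix n n ℂ) : ℝ :=
  Real.sqrt (Matrix.trace (star M * M)).re

section aux
open scoped Matrix.Norms.L2Operator in
lemma aux_span (d : ℕ) :
    Submodule.span ℂ ((unitary (Matrix (Fin d) (Fin d) ℂ) : Set (Matrix (Fin d) (Fin d) ℂ))) = ⊤ :=
  letI : CStarAlgebra (Matrix (Fin d) (Fin d) ℂ) := {}
  CStarAlgebra.span_unitary _

lemma aux_scalar (d : ℕ) (M : Matrix (Fin d) (Fin d) ℂ)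
    (h : ∀ W ∈ unitary (Matrix (Fin d) (Fin d) ℂ), W * M = M * W) :
    ∃ c : ℂ, M = c • (1 : Matrix (Fin d) (Fin d) ℂ) := by
  have key : ∀ A : Matrix (Fin d) (Fin d) ℂ, A * M = M * A := by
    intro A
    have hA : A ∈ Submodule.span ℂ
        ((unitary (Matrix (Fin d) (Fin d) ℂ) : Set (Matrix (Fin d) (Fin d) ℂ))) := by
      rw [aux_span]; trivial
    induction hA using Submodule.span_induction with
    | mem x hx => exact h x hx
    | zero => simp
    | add x y _ _ hx hy => rw [add_mul, mul_add, hx, hy]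
    | smul a x _ hx => rw [smul_mul_assoc, mul_smul_comm, hx]
  obtain ⟨c, hc⟩ := Matrix.mem_range_scalar_of_commute_single (M := M)
    (fun i j _ => key _)
  refine ⟨c, ?_⟩
  rw [← hc, Matrix.smul_one_eq_diagonal]
  rfl

lemma aux_lin {α E F : Type*} [MeasurableSpace α] {μ : Measure α} [NormedAddCommGroup E]
    [NormedSpace ℂ E] [FiniteDimensional ℂ E] [NormedAddCommGroup F] [NormedSpace ℂ F]
    [FiniteDimensional ℂ F] (L : E →ₗ[ℂ] F) (f : α → E) (hf : Integrable f μ) :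
    ∫ x, L (f x) ∂μ = L (∫ x, f x ∂μ) := by
  have : CompleteSpace E := FiniteDimensional.complete ℂ E
  have : CompleteSpace F := FiniteDimensional.complete ℂ F
  exact (LinearMap.toContinuousLinearMap L).integral_comp_comm hf

lemma aux_int {α E : Type*} [MeasurableSpace α] [TopologicalSpace α] [OpensMeasurableSpace α]
    [SecondCountableTopology α] {μ : Measure α} [IsFiniteMeasure μ] [NormedAddCommGroup E]
    (f : α → E) (hf : Continuous f) (C : ℝ) (hC : ∀ x, ‖f x‖ ≤ C) : Integrable f μ :=
  Integrable.of_bound hf.aestronglyMeasurable C (Filter.Eventually.of_forall hC)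

lemma aux_integrable (d : ℕ) (μ : Measure (Matrix.unitaryGroup (Fin d) ℂ))
    [IsProbabilityMeasure μ] (ρ : Matrix (Fin d) (Fin d) ℂ) :
    @Integrable (Matrix (Fin d) (Fin d) ℂ)
      (PseudoMetricSpace.toUniformSpace.toTopologicalSpace) _
      (Matrix.unitaryGroup (Fin d) ℂ) _
      (fun V : Matrix.unitaryGroup (Fin d) ℂ => V.1 * ρ * star V.1) μ := by
  have hc : Continuous (fun V : Matrix.unitaryGroup (Fin d) ℂ => V.1 * ρ * star V.1) := by
    fun_prop
  have hb : ∀ V : Matrix.unitaryGroup (Fin d) ℂ, ‖V.1‖ ≤ d := by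
    intro V
    rw [Matrix.frobenius_norm_def]
    have h1 : ∑ i, ∑ j, ‖V.1 i j‖ ^ (2 : ℝ) ≤ (d : ℝ) ^ (2 : ℝ) := by
      calc ∑ i, ∑ j, ‖V.1 i j‖ ^ (2 : ℝ) ≤ ∑ _i : Fin d, ∑ _j : Fin d, (1 : ℝ) := by
            refine Finset.sum_le_sum fun i _ => Finset.sum_le_sum fun j _ => ?_
            exact Real.rpow_le_one (norm_nonneg _) (entry_norm_bound_of_unitary V.2 i j)
              (by norm_num)
        _ = (d : ℝ) ^ (2 : ℝ) := by simp [sq]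
    calc _ ≤ ((d : ℝ) ^ (2 : ℝ)) ^ (1 / 2 : ℝ) :=
          Real.rpow_le_rpow (by positivity) h1 (by norm_num)
      _ = d := by rw [← Real.rpow_mul (by positivity)]; norm_num
  have : SecondCountableTopology (Matrix (Fin d) (Fin d) ℂ) :=
    inferInstanceAs (SecondCountableTopology (Fin d → Fin d → ℂ))
  have h2 : SecondCountableTopology (Matrix.unitaryGroup (Fin d) ℂ) :=
    TopologicalSpace.Subtype.secondCountableTopology
      (Matrix.unitaryGroup (Fin d) ℂ : Set (Matrix (Fin d) (Fin d) ℂ))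
  refine aux_int _ hc (d * ‖ρ‖ * d) ?_
  intro V
  have h1 := Matrix.frobenius_norm_mul (V.1 * ρ) (star V.1)
  have h2 := Matrix.frobenius_norm_mul V.1 ρ
  have h3 : ‖star V.1‖ = ‖V.1‖ := Matrix.frobenius_norm_conjTranspose _
  have h4 := hb V
  rw [h3] at h1
  refine h1.trans ?_
  gcongr
  refine h2.trans ?_
  gcongr

end aux

/-- The Haar average of `V ρ V†` equals `(Tr[ρ]/d) • I`; in particular if `Tr[ρ] = 1`
then this average is `I/d`. -/
theorem haar_average_conjugation (d : ℕ) (hd : 1 ≤ d)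
    (μ : Measure (Matrix.unitaryGroup (Fin d) ℂ))
    [μ.IsHaarMeasure] [IsProbabilityMeasure μ]
    (ρ : Matrix (Fin d) (Fin d) ℂ) :
    (∫ V : Matrix.unitaryGroup (Fin d) ℂ, V.1 * ρ * star V.1 ∂μ)
        = (ρ.trace / (d : ℂ)) • (1 : Matrix (Fin d) (Fin d) ℂ)
      ∧ (ρ.trace = 1 →
          (∫ V : Matrix.unitaryGroup (Fin d) ℂ, V.1 * ρ * star V.1 ∂μ)
            = ((d : ℂ))⁻¹ • (1 : Matrix (Fin d) (Fin d) ℂ)) := by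
  classical
  have hint := aux_integrable d μ ρ
  have hd0 : (d : ℂ) ≠ 0 := by exact_mod_cast (by omega : d ≠ 0)
  have main : (∫ V : Matrix.unitaryGroup (Fin d) ℂ, V.1 * ρ * star V.1 ∂μ)
        = (ρ.trace / (d : ℂ)) • (1 : Matrix (Fin d) (Fin d) ℂ) := by
    set M := ∫ V : Matrix.unitaryGroup (Fin d) ℂ, V.1 * ρ * star V.1 ∂μ with hM
    have hcomm : ∀ W ∈ unitary (Matrix (Fin d) (Fin d) ℂ), W * M = M * W := by
      intro W hW
      let L : Matrix (Fin d) (Fin d) ℂ →ₗ[ℂ] Matrix (Fin d) (Fin d) ℂ :=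
          ((LinearMap.mulLeft ℂ W).comp (LinearMap.mulRight ℂ (star W)))
      have hL : ∀ A, L A = W * (A * star W) := fun A => rfl
      have h1 := aux_lin L _ hint
      have h2 := integral_mul_left_eq_self (μ := μ)
        (fun V : Matrix.unitaryGroup (Fin d) ℂ => V.1 * ρ * star V.1) ⟨W, hW⟩
      have h3 : L M = M := by
        rw [hM, ← h1]
        refine Eq.trans ?_ h2
        congr 1
        ext1 V
        rw [hL]
        simp [mul_assoc]
      rw [hL] at h3
      have h4 : star W * W = 1 := (Unitary.mem_iff.mp hW).1
      calc W * M = W * M * (star W * W) := by rw [h4, mul_one]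
        _ = (W * (M * star W)) * W := by simp only [mul_assoc]
        _ = M * W := by rw [h3]
    obtain ⟨c, hc⟩ := aux_scalar d M hcomm
    let T : Matrix (Fin d) (Fin d) ℂ →ₗ[ℂ] ℂ :=
      (Matrix.traceLinearMap (Fin d) ℂ ℂ)
    have hT : ∀ A, T A = A.trace := fun A => rfl
    have h5 := aux_lin T _ hint
    have h6 : M.trace = ρ.trace := by
      rw [← hT, hM, ← h5]
      have : ∀ V : Matrix.unitaryGroup (Fin d) ℂ, T (V.1 * ρ * star V.1) = ρ.trace := by
        intro V
        rw [hT, Matrix.trace_mul_comm, ← mul_assoc, (Unitary.mem_iff.mp V.2).1, one_mul]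
      simp [this]
    have h7 : c * d = ρ.trace := by
      rw [← h6, hc]; simp
    rw [hc, ← h7, mul_div_cancel_right₀ _ hd0]
  refine ⟨main, fun h => ?_⟩
  rw [main, h, one_div]
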